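/- Let s ∈ (0,1) and let f : ℝ → ℝ be of class C^{1,γ} for some γ > max(0, 1−2s). If there exists a layer solution v of (-∂ₓₓ)^s v = f(v) in ℝ, then f(−1) = f(1) = 0 (equivalently G′(−1) = G′(1) = 0) and G(r) > G(−1) = G(1) for every r ∈ (−1,1). -/

import Mathlib

open Real MeasureTheory Filter Set

/-- Normalizing constant of the one-dimensional fractional Laplacian. -/
noncomputable def fracLapCoef (s : ℝ) : ℝ :=
  (4:ℝ) ^ s * s * Real.Gamma (s + 1/2) / (Real.sqrt π * Real.Gamma (1 - s))

/-- The one-dimensional fractional Laplacian `(-∂ₓₓ)^s v (x)`. -/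
noncomputable def fracLap (s : ℝ) (v : ℝ → ℝ) (x : ℝ) : ℝ :=
  fracLapCoef s * ∫ y in Set.Ioi (0:ℝ), (2 * v x - v (x + y) - v (x - y)) * y ^ (-1 - 2*s)

/-- `f` is of class `C^{1,γ}`: continuously differentiable with `γ`-Hölder derivative. -/
def IsC1Holder (γ : ℝ) (f : ℝ → ℝ) : Prop :=
  ContDiff ℝ 1 f ∧ ∃ C : ℝ, ∀ x y : ℝ, |deriv f x - deriv f y| ≤ C * |x - y| ^ γ

/-- A layer solution of `(-∂ₓₓ)^s v = f(v)` in `ℝ`. -/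
structure IsLayerSolution (s : ℝ) (f : ℝ → ℝ) (v : ℝ → ℝ) : Prop where
  bounded : ∃ M : ℝ, ∀ x, |v x| ≤ M
  smooth : ContDiff ℝ 2 v
  eqn : ∀ x, fracLap s v x = f (v x)
  mono : ∀ x, 0 < deriv v x
  limNeg : Tendsto v atBot (nhds (-1))
  limPos : Tendsto v atTop (nhds 1)

/-- The potential `G(r) = -∫₀^r f`. -/
noncomputable def potG (f : ℝ → ℝ) (r : ℝ) : ℝ := -∫ u in (0:ℝ)..r, f u

/-- the dominating kernel -/
lemma ker_int {s : ℝ} (hs : s ∈ Set.Ioo (0:ℝ) 1) :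
    IntegrableOn (fun y : ℝ => min (y^2) 1 * y ^ (-1 - 2*s)) (Set.Ioi 0) := by
  have hmeas : Measurable (fun y : ℝ => min (y^2) 1 * y ^ (-1 - 2*s)) := by fun_prop
  have h1 : IntegrableOn (fun y : ℝ => min (y^2) 1 * y ^ (-1 - 2*s)) (Set.Ioc 0 1) := by
    have : IntegrableOn (fun y : ℝ => y ^ (1 - 2*s)) (Set.Ioc 0 1) :=
      (intervalIntegrable_iff_integrableOn_Ioc_of_le zero_le_one).1
        (intervalIntegral.intervalIntegrable_rpow' (by linarith [hs.2]))
    refine Integrable.mono' this hmeas.aestronglyMeasurable ?_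
    filter_upwards [ae_restrict_mem measurableSet_Ioc] with y hy
    have hk : 0 ≤ y ^ (-1 - 2*s) := rpow_nonneg hy.1.le _
    rw [Real.norm_of_nonneg (by positivity)]
    have : y ^ (1 - 2*s) = y^2 * y ^ (-1 - 2*s) := by
      rw [← Real.rpow_natCast, ← Real.rpow_add hy.1]; congr 1; push_cast; ring
    rw [this]
    gcongr
    exact min_le_left _ _
  have h2 : IntegrableOn (fun y : ℝ => min (y^2) 1 * y ^ (-1 - 2*s)) (Set.Ioi 1) := by
    have : IntegrableOn (fun y : ℝ => y ^ (-1 - 2*s)) (Set.Ioi 1) :=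
      integrableOn_Ioi_rpow_of_lt (by linarith [hs.1]) one_pos
    refine Integrable.mono' this hmeas.aestronglyMeasurable ?_
    filter_upwards [ae_restrict_mem measurableSet_Ioi] with y hy
    have hy0 : (0:ℝ) < y := lt_trans one_pos hy
    have hk : 0 ≤ y ^ (-1 - 2*s) := rpow_nonneg hy0.le _
    rw [Real.norm_of_nonneg (by positivity)]
    exact mul_le_of_le_one_left hk (min_le_right _ _)
  have := h1.union h2
  rwa [Set.Ioc_union_Ioi_eq_Ioi zero_le_one] at this

/-- domination criterion -/
lemma dom_int {s : ℝ} (hs : s ∈ Set.Ioo (0:ℝ) 1) {g : ℝ → ℝ} (hg : Measurable g) {A B : ℝ}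
    (hA : 0 ≤ A) (h1 : ∀ y, 0 < y → y ≤ 1 → |g y| ≤ A * y^2) (h2 : ∀ y, 0 < y → |g y| ≤ B) :
    IntegrableOn (fun y : ℝ => g y * y ^ (-1 - 2*s)) (Set.Ioi 0) ∧
    ∀ y, 0 < y → |g y * y ^ (-1 - 2*s)| ≤ (A + B) * (min (y^2) 1 * y ^ (-1 - 2*s)) := by
  have key : ∀ y, 0 < y → |g y * y ^ (-1 - 2*s)| ≤ (A + B) * (min (y^2) 1 * y ^ (-1 - 2*s)) := by
    intro y hy
    have hk : 0 ≤ y ^ (-1 - 2*s) := rpow_nonneg hy.le _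
    rw [abs_mul, abs_of_nonneg hk, ← mul_assoc]
    refine mul_le_mul_of_nonneg_right ?_ hk
    have hB := (abs_nonneg _).trans (h2 y hy)
    rcases le_total y 1 with h | h
    · rw [min_eq_left (by nlinarith)]
      nlinarith [h1 y hy h, sq_nonneg y]
    · rw [min_eq_right (by nlinarith)]
      linarith [h2 y hy]
  refine ⟨?_, key⟩
  refine Integrable.mono' ((ker_int hs).const_mul (A+B)) ?_ ?_
  · exact (hg.mul (by fun_prop)).aestronglyMeasurable
  · filter_upwards [ae_restrict_mem measurableSet_Ioi] with y hy
    exact key y hy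

/-- dominated convergence with the kernel -/
lemma dom_conv {s : ℝ} (hs : s ∈ Set.Ioo (0:ℝ) 1) {g : ℕ → ℝ → ℝ} (hg : ∀ n, Measurable (g n))
    {A B : ℝ} (hA : 0 ≤ A) (h1 : ∀ n, ∀ y, 0 < y → y ≤ 1 → |g n y| ≤ A * y^2)
    (h2 : ∀ n, ∀ y, 0 < y → |g n y| ≤ B)
    (h3 : ∀ y, 0 < y → Tendsto (fun n => g n y) atTop (nhds 0)) :
    Tendsto (fun n => ∫ y in Set.Ioi (0:ℝ), g n y * y ^ (-1 - 2*s)) atTop (nhds 0) := by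
  have := tendsto_integral_of_dominated_convergence (μ := volume.restrict (Set.Ioi (0:ℝ)))
    (F := fun n y => g n y * y ^ (-1 - 2*s)) (f := fun _ => 0)
    (fun y => (A + B) * (min (y^2) 1 * y ^ (-1 - 2*s)))
    (fun n => ((hg n).mul (by fun_prop)).aestronglyMeasurable)
    ((ker_int hs).const_mul (A+B)) ?_ ?_
  · simpa using this
  · intro n
    filter_upwards [ae_restrict_mem measurableSet_Ioi] with y hy
    exact (dom_int hs (hg n) hA (h1 n) (h2 n)).2 y hy
  · filter_upwards [ae_restrict_mem measurableSet_Ioi] with y hy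
    simpa using (h3 y hy).mul_const (y ^ (-1 - 2*s))

lemma coef_pos {s : ℝ} (hs : s ∈ Set.Ioo (0:ℝ) 1) : 0 < fracLapCoef s := by
  have h1 := hs.1
  have h2 := hs.2
  have := Real.Gamma_pos_of_pos (show 0 < s + 1/2 by linarith)
  have := Real.Gamma_pos_of_pos (show 0 < 1 - s by linarith)
  unfold fracLapCoef
  have := Real.pi_pos
  positivity

/-- touching from above by translated parabolas -/
lemma touch {w : ℝ → ℝ} (hw : Continuous w) {M : ℝ} (hM : ∀ x, |w x| ≤ M) :
    ∃ C : ℝ, 0 ≤ C ∧ ∃ x c : ℕ → ℝ, Tendsto x atTop atBot ∧ (∀ n, |c n| ≤ C) ∧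
      ∀ n y, w (x n + y) - w (x n) ≤ c n * y + y^2 := by
  have h : ∀ n : ℕ, ∃ x : ℝ, ∀ y, w y - (y + n)^2 ≤ w x - (x + n)^2 := by
    intro n
    have hc : Continuous (fun y : ℝ => w y - (y + n)^2) := by fun_prop
    refine hc.exists_forall_ge ?_
    have : Tendsto (fun y : ℝ => (y + n)^2) (cocompact ℝ) atTop := by
      have h1 : Tendsto (fun y : ℝ => y + n) (cocompact ℝ) (cocompact ℝ) :=
        (Homeomorph.addRight (n:ℝ)).isClosedEmbedding.tendsto_cocompact
      have h2 := (tendsto_pow_atTop (α := ℝ) two_ne_zero).comp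
        ((tendsto_norm_cocompact_atTop (E := ℝ)).comp h1)
      refine h2.congr fun y => ?_
      simp
    have h2 : Tendsto (fun y : ℝ => M - (y + n)^2) (cocompact ℝ) atBot :=
      tendsto_const_nhds.add_atBot (tendsto_neg_atTop_atBot.comp this)
    exact tendsto_atBot_mono (fun y => by linarith [(abs_le.1 (hM y)).2]) h2
  choose x hx using h
  have hb : ∀ n : ℕ, |x n + n| ≤ 2 * M + 1 := by
    intro n
    have h1 := hx n (-n)
    have h2 := abs_le.1 (hM (-n))
    have h3 := abs_le.1 (hM (x n))
    have h0 := (abs_nonneg _).trans (hM 0)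
    have h4 : (x n + n)^2 ≤ 2 * M := by
      simp at h1; linarith
    apply abs_le_of_sq_le_sq _ (by linarith)
    nlinarith
  refine ⟨2 * (2 * M + 1), ?_, x, fun n => 2 * (x n + n), ?_, ?_, ?_⟩
  · have h0 := (abs_nonneg _).trans (hM 0)
    linarith
  · have : Tendsto (fun n : ℕ => (2 * M + 1) + -(n:ℝ)) atTop atBot :=
      tendsto_const_nhds.add_atBot (tendsto_neg_atTop_atBot.comp tendsto_natCast_atTop_atTop)
    exact tendsto_atBot_mono (fun n => by linarith [(abs_le.1 (hb n)).2]) this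
  · intro n
    rw [abs_mul, abs_of_pos (by norm_num : (0:ℝ) < 2)]
    linarith [hb n]
  · intro n y
    have := hx n (x n + y)
    nlinarith

/-- the negative parts of second differences vanish along touching points -/
lemma neg_part {s : ℝ} (hs : s ∈ Set.Ioo (0:ℝ) 1) {w : ℝ → ℝ} (hw : Continuous w) {M l : ℝ}
    (hM : ∀ x, |w x| ≤ M) (hl : Tendsto w atBot (nhds l)) {x c : ℕ → ℝ}
    (hx : Tendsto x atTop atBot) (ht : ∀ n y, w (x n + y) - w (x n) ≤ c n * y + y^2) :
    (∀ n, IntegrableOn (fun y : ℝ =>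
      max (-(2 * w (x n) - w (x n + y) - w (x n - y))) 0 * y ^ (-1 - 2*s)) (Set.Ioi 0)) ∧
    Tendsto (fun n => ∫ y in Set.Ioi (0:ℝ),
      max (-(2 * w (x n) - w (x n + y) - w (x n - y))) 0 * y ^ (-1 - 2*s)) atTop (nhds 0) := by
  have hm : ∀ n, Measurable fun y : ℝ => max (-(2 * w (x n) - w (x n + y) - w (x n - y))) 0 :=
    fun n => Continuous.measurable (by fun_prop)
  have h1 : ∀ n, ∀ y : ℝ, 0 < y → y ≤ 1 →
      |max (-(2 * w (x n) - w (x n + y) - w (x n - y))) 0| ≤ 2 * y^2 := by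
    intro n y _ _
    rw [abs_of_nonneg (le_max_right _ _)]
    have a1 := ht n y
    have a2 := ht n (-y)
    rw [← sub_eq_add_neg] at a2
    exact max_le (by nlinarith) (by positivity)
  have h2 : ∀ n, ∀ y : ℝ, 0 < y →
      |max (-(2 * w (x n) - w (x n + y) - w (x n - y))) 0| ≤ 4 * M := by
    intro n y _
    rw [abs_of_nonneg (le_max_right _ _)]
    have a1 := abs_le.1 (hM (x n))
    have a2 := abs_le.1 (hM (x n + y))
    have a3 := abs_le.1 (hM (x n - y))
    exact max_le (by linarith) (by linarith)
  refine ⟨fun n => (dom_int hs (hm n) zero_le_two (h1 n) (h2 n)).1,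
    dom_conv hs hm zero_le_two h1 h2 ?_⟩
  intro y _
  have b1 := hl.comp hx
  have b2 := hl.comp (tendsto_atBot_add_const_right _ y hx)
  have b3 := hl.comp (tendsto_atBot_add_const_right _ (-y) hx)
  have := (((b1.const_mul 2).sub b2).sub b3).neg.max (tendsto_const_nhds (x := (0:ℝ)))
  have e0 : max (-(2 * l - l - l)) 0 = 0 := by
    rw [show -(2 * l - l - l) = 0 by ring, max_self]
  rw [e0] at this
  simpa only [Function.comp, sub_eq_add_neg] using this

lemma lap_nonneg {s : ℝ} (hs : s ∈ Set.Ioo (0:ℝ) 1) {w : ℝ → ℝ} (hw : Continuous w) {M l m : ℝ}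
    (hM : ∀ x, |w x| ≤ M) (hl : Tendsto w atBot (nhds l))
    (hm : Tendsto (fracLap s w) atBot (nhds m)) : 0 ≤ m := by
  obtain ⟨C, hC, x, c, hx, hc, ht⟩ := touch hw hM
  obtain ⟨hi, hlim⟩ := neg_part hs hw hM hl hx ht
  have h1 := (hlim.neg).const_mul (fracLapCoef s)
  simp only [neg_zero, mul_zero] at h1
  refine le_of_tendsto_of_tendsto' h1 (hm.comp hx) fun n => ?_
  simp only [Function.comp, fracLap]
  refine mul_le_mul_of_nonneg_left ?_ (coef_pos hs).le
  by_cases hint : IntegrableOn (fun y : ℝ =>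
      (2 * w (x n) - w (x n + y) - w (x n - y)) * y ^ (-1 - 2*s)) (Set.Ioi 0)
  · rw [← integral_neg]
    refine setIntegral_mono_on (hi n).neg hint measurableSet_Ioi fun y hy => ?_
    have hk : 0 ≤ y ^ (-1 - 2*s) := rpow_nonneg (le_of_lt hy) _
    rw [← neg_mul]
    refine mul_le_mul_of_nonneg_right ?_ hk
    linarith [le_max_left (-(2 * w (x n) - w (x n + y) - w (x n - y))) 0]
  · rw [integral_undef hint, neg_nonpos]
    refine setIntegral_nonneg measurableSet_Ioi fun y hy => ?_
    have hk : 0 ≤ y ^ (-1 - 2*s) := rpow_nonneg (le_of_lt hy) _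
    exact mul_nonneg (le_max_right _ _) hk

lemma fracLap_neg (s : ℝ) (w : ℝ → ℝ) (x : ℝ) :
    fracLap s (fun t => - w t) x = - fracLap s w x := by
  unfold fracLap
  rw [← mul_neg, ← integral_neg]
  congr 2
  ext y
  ring

lemma fracLap_refl (s : ℝ) (w : ℝ → ℝ) (x : ℝ) :
    fracLap s (fun t => w (-t)) x = fracLap s w (-x) := by
  unfold fracLap
  congr 2
  ext y
  beta_reduce
  rw [show -(x+y) = -x - y by ring, show -(x-y) = -x + y by ring]
  ring

lemma sd_bound {v : ℝ → ℝ} (hv : ContDiff ℝ 2 v) (a b : ℝ) :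
    ∃ A : ℝ, 0 ≤ A ∧ (∀ x ∈ Set.Icc a b, |deriv v x| ≤ A) ∧
      (∀ x ∈ Set.Icc a b, ∀ y : ℝ, 0 < y → y ≤ 1 →
        |v (x + y) - v x| ≤ A * y ∧ |v x - v (x - y)| ≤ A * y ∧
        |2 * v x - v (x + y) - v (x - y)| ≤ A * y^2) := by
  have hd : Differentiable ℝ v := hv.differentiable (by norm_num)
  have hv1 : ContDiff ℝ 1 (deriv v) := by
    have h2 : ContDiff ℝ (1 + 1) v := by
      rw [one_add_one_eq_two]; exact hv
    exact (contDiff_succ_iff_deriv.1 h2).2.2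
  have hd1 : Differentiable ℝ (deriv v) := hv1.differentiable (by norm_num)
  have hc1 : Continuous (deriv v) := hv1.continuous
  have hc2 : Continuous (deriv (deriv v)) := hv1.continuous_deriv (le_refl _)
  obtain ⟨A1, hA1⟩ := (isCompact_Icc (a := a - 1) (b := b + 1)).exists_bound_of_continuousOn
    hc1.continuousOn
  obtain ⟨A2, hA2⟩ := (isCompact_Icc (a := a - 1) (b := b + 1)).exists_bound_of_continuousOn
    hc2.continuousOn
  have L1 : ∀ x ∈ Set.Icc (a-1) (b+1), ∀ y ∈ Set.Icc (a-1) (b+1), |v y - v x| ≤ A1 * |y - x| :=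
    fun x hx y hy => Convex.norm_image_sub_le_of_norm_deriv_le (fun z _ => hd z) hA1
      (convex_Icc _ _) hx hy
  have L2 : ∀ x ∈ Set.Icc (a-1) (b+1), ∀ y ∈ Set.Icc (a-1) (b+1),
      |deriv v y - deriv v x| ≤ A2 * |y - x| :=
    fun x hx y hy => Convex.norm_image_sub_le_of_norm_deriv_le (fun z _ => hd1 z) hA2
      (convex_Icc _ _) hx hy
  refine ⟨|A1| + 2 * |A2|, by positivity, ?_, ?_⟩
  · intro x hx
    have := hA1 x ⟨by linarith [hx.1], by linarith [hx.2]⟩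
    rw [Real.norm_eq_abs] at this
    linarith [le_abs_self A1, abs_nonneg A2]
  · intro x hx y hy0 hy1
    have mx : x ∈ Set.Icc (a-1) (b+1) := ⟨by linarith [hx.1], by linarith [hx.2]⟩
    have mp : x + y ∈ Set.Icc (a-1) (b+1) := ⟨by linarith [hx.1], by linarith [hx.2]⟩
    have mm : x - y ∈ Set.Icc (a-1) (b+1) := ⟨by linarith [hx.1], by linarith [hx.2]⟩
    have e1 := L1 x mx _ mp
    have e2 := L1 _ mm x mx
    have hle : A1 * y ≤ (|A1| + 2 * |A2|) * y :=
      mul_le_mul_of_nonneg_right (by linarith [le_abs_self A1, abs_nonneg A2]) hy0.le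
    rw [show x + y - x = y by ring, abs_of_pos hy0] at e1
    rw [show x - (x - y) = y by ring, abs_of_pos hy0] at e2
    refine ⟨e1.trans hle, e2.trans hle, ?_⟩
    have hder : ∀ t : ℝ, HasDerivAt (fun t => 2 * v x - v (x + t) - v (x - t))
        (deriv v (x - t) - deriv v (x + t)) t := by
      intro t
      have d1 : HasDerivAt (fun t => v (x + t)) (deriv v (x + t)) t := by
        simpa using (hd (x+t)).hasDerivAt.comp_const_add x t
      have d2 : HasDerivAt (fun t => v (x - t)) (-deriv v (x - t)) t := by
        simpa using (hd (x-t)).hasDerivAt.comp_const_sub x t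
      have d3 := (d1.const_sub (2 * v x)).sub d2
      rw [show -deriv v (x + t) - -deriv v (x - t) = deriv v (x - t) - deriv v (x + t) by ring] at d3
      exact d3
    have := norm_image_sub_le_of_norm_deriv_le_segment' (a := 0) (b := y)
      (f := fun t => 2 * v x - v (x + t) - v (x - t)) (C := 2 * |A2| * y)
      (fun t _ => (hder t).hasDerivWithinAt) ?_ y ⟨hy0.le, le_refl _⟩
    · simp only [add_zero, sub_zero, Real.norm_eq_abs] at this
      rw [show 2 * v x - v x - v x = 0 by ring, sub_zero] at this
      nlinarith [abs_nonneg A1, sq_nonneg y, mul_nonneg (abs_nonneg A1) (sq_nonneg y)]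
    · intro t ht
      have m1 : x - t ∈ Set.Icc (a-1) (b+1) := ⟨by linarith [hx.1, ht.2], by linarith [hx.2, ht.1]⟩
      have m2 : x + t ∈ Set.Icc (a-1) (b+1) := ⟨by linarith [hx.1, ht.1], by linarith [hx.2, ht.2]⟩
      have := L2 _ m2 _ m1
      rw [show x - t - (x + t) = -(2*t) by ring, abs_neg, abs_of_nonneg (show 0 ≤ 2 * t by linarith [ht.1])] at this
      rw [Real.norm_eq_abs]
      have h3 : A2 * (2 * t) ≤ |A2| * (2 * y) :=
        mul_le_mul (le_abs_self _) (by linarith [ht.2]) (by linarith [ht.1]) (abs_nonneg _)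
      linarith

/-- the boundary defect -/
noncomputable def defect (v : ℝ → ℝ) (c y : ℝ) : ℝ :=
  ∫ x in (c - y)..c, deriv v x * (v (x + y) - v c)

lemma defect_cont {v : ℝ → ℝ} (hv : Continuous v) (hv1 : Continuous (deriv v)) (c : ℝ) :
    Continuous (defect v c) := by
  have : defect v c = fun y => - ∫ x in c..(c - y), deriv v x * (v (x + y) - v c) := by
    ext y
    rw [defect, intervalIntegral.integral_symm]
  rw [this]
  refine Continuous.neg ?_
  refine intervalIntegral.continuous_parametric_intervalIntegral_of_continuous
    (f := fun y x => deriv v x * (v (x + y) - v c)) ?_ (by fun_prop)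
  simp only [Function.uncurry_def]
  fun_prop

lemma defect_diff {v : ℝ → ℝ} (hd : Differentiable ℝ v) (hv1 : Continuous (deriv v)) (a b y : ℝ) :
    ∫ x in a..b, deriv v x * (2 * v x - v (x + y) - v (x - y)) = defect v a y - defect v b y := by
  have hv : Continuous v := hd.continuous
  have hg : Continuous (fun x => deriv v x * v (x + y)) := by fun_prop
  set T : ℝ → ℝ := fun c => ∫ x in (0:ℝ)..c, deriv v x * v (x + y) with hT
  have hTd : ∀ c, HasDerivAt T (deriv v c * v (c + y)) c := fun c =>
    hg.integral_hasStrictDerivAt 0 c |>.hasDerivAt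
  have hD : ∀ c, defect v c y = T c - T (c - y) - v c * (v c - v (c - y)) := by
    intro c
    have e1 : ∫ x in (c-y)..c, deriv v x = v c - v (c - y) :=
      intervalIntegral.integral_deriv_eq_sub (fun x _ => hd x) (hv1.intervalIntegrable _ _)
    have e2 : T c - T (c - y) = ∫ x in (c-y)..c, deriv v x * v (x + y) :=
      intervalIntegral.integral_interval_sub_left (hg.intervalIntegrable _ _)
        (hg.intervalIntegrable _ _)
    rw [e2, ← e1, ← intervalIntegral.integral_const_mul, ← intervalIntegral.integral_sub
      (hg.intervalIntegrable _ _) ((hv1.const_mul _ ).intervalIntegrable _ _)]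
    unfold defect
    congr 1
    ext x
    ring
  have hder : ∀ c, HasDerivAt (fun c => - defect v c y)
      (deriv v c * (2 * v c - v (c + y) - v (c - y))) c := by
    intro c
    have h1 := (hTd (c - y)).comp_sub_const c y
    have h2 := (hd c).hasDerivAt
    have h3 := ((hd (c - y)).hasDerivAt).comp_sub_const c y
    have h4 := (((hTd c).sub h1).sub (h2.mul (h2.sub h3))).neg
    have h5 : (fun c => - defect v c y) = -(T - (fun x => T (x - y)) -
        v * (v - fun x => v (x - y))) := by
      ext z
      simp [hD z]
    rw [h5]
    refine h4.congr_deriv ?_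
    simp only [Pi.sub_apply]
    ring
  rw [intervalIntegral.integral_eq_sub_of_hasDerivAt (fun c _ => hder c)
    (Continuous.intervalIntegrable (by fun_prop) _ _)]
  ring

lemma defect_bounds {v : ℝ → ℝ} (hd : Differentiable ℝ v) (hv1 : Continuous (deriv v))
    (hpos : ∀ x, 0 < deriv v x) (c y : ℝ) (hy : 0 < y) :
    0 < defect v c y ∧ defect v c y ≤ (v (c + y) - v c) * (v c - v (c - y)) := by
  have hv : Continuous v := hd.continuous
  have hm : StrictMono v := strictMono_of_deriv_pos hpos
  have hc : Continuous (fun x => deriv v x * (v (x + y) - v c)) := by fun_prop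
  constructor
  · refine intervalIntegral.intervalIntegral_pos_of_pos_on (hc.intervalIntegrable _ _) ?_
      (by linarith)
    intro x hx
    exact mul_pos (hpos x) (sub_pos.2 (hm (by linarith [hx.1])))
  · have e1 : ∫ x in (c-y)..c, deriv v x = v c - v (c - y) :=
      intervalIntegral.integral_deriv_eq_sub (fun x _ => hd x) (hv1.intervalIntegrable _ _)
    rw [← e1, ← intervalIntegral.integral_const_mul]
    refine intervalIntegral.integral_mono_on (by linarith) (hc.intervalIntegrable _ _)
      ((hv1.const_mul _ ).intervalIntegrable _ _) ?_
    intro x hx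
    rw [mul_comm]
    refine mul_le_mul_of_nonneg_right ?_ (hpos x).le
    linarith [hm.monotone (show x + y ≤ c + y by linarith [hx.2])]

/-- the boundary energy -/
noncomputable def bEn (s : ℝ) (v : ℝ → ℝ) (c : ℝ) : ℝ :=
  ∫ y in Set.Ioi (0:ℝ), defect v c y * y ^ (-1 - 2*s)

lemma defect_int {s : ℝ} (hs : s ∈ Set.Ioo (0:ℝ) 1) {v : ℝ → ℝ} (hv : ContDiff ℝ 2 v)
    (hpos : ∀ x, 0 < deriv v x) {M : ℝ} (hM : ∀ x, |v x| ≤ M) (c : ℝ) :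
    IntegrableOn (fun y : ℝ => defect v c y * y ^ (-1 - 2*s)) (Set.Ioi 0) := by
  have hd : Differentiable ℝ v := hv.differentiable (by norm_num)
  have hv1 : Continuous (deriv v) := hv.continuous_deriv (by norm_num)
  have hm : StrictMono v := strictMono_of_deriv_pos hpos
  obtain ⟨A, hA, -, hA2⟩ := sd_bound hv c c
  refine (dom_int hs (defect_cont hd.continuous hv1 c).measurable (A := A * A)
    (B := (2 * M) * (2 * M)) (by positivity) ?_ ?_).1
  · intro y hy hy1
    obtain ⟨h1, h2⟩ := defect_bounds hd hv1 hpos c y hy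
    obtain ⟨b1, b2, -⟩ := hA2 c ⟨le_refl _, le_refl _⟩ y hy hy1
    rw [abs_of_pos h1]
    refine h2.trans ?_
    have g2 : 0 ≤ v c - v (c - y) := sub_nonneg.2 (hm.monotone (by linarith))
    calc _ ≤ (A * y) * (A * y) := mul_le_mul ((le_abs_self _).trans b1)
            ((le_abs_self _).trans b2) g2 (by positivity)
      _ = _ := by ring
  · intro y hy
    obtain ⟨h1, h2⟩ := defect_bounds hd hv1 hpos c y hy
    rw [abs_of_pos h1]
    refine h2.trans ?_
    have g2 : 0 ≤ v c - v (c - y) := sub_nonneg.2 (hm.monotone (by linarith))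
    have a1 := abs_le.1 (hM c)
    have a2 := abs_le.1 (hM (c + y))
    have a3 := abs_le.1 (hM (c - y))
    exact mul_le_mul (by linarith) (by linarith) g2 (by linarith)

lemma bEn_pos {s : ℝ} (hs : s ∈ Set.Ioo (0:ℝ) 1) {v : ℝ → ℝ} (hv : ContDiff ℝ 2 v)
    (hpos : ∀ x, 0 < deriv v x) {M : ℝ} (hM : ∀ x, |v x| ≤ M) (c : ℝ) : 0 < bEn s v c := by
  have hd : Differentiable ℝ v := hv.differentiable (by norm_num)
  have hv1 : Continuous (deriv v) := hv.continuous_deriv (by norm_num)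
  have hp : ∀ y ∈ Set.Ioi (0:ℝ), 0 < defect v c y * y ^ (-1 - 2*s) := fun y hy =>
    mul_pos (defect_bounds hd hv1 hpos c y hy).1 (rpow_pos_of_pos hy _)
  unfold bEn
  rw [setIntegral_pos_iff_support_of_nonneg_ae]
  · have : Function.support (fun y : ℝ => defect v c y * y ^ (-1 - 2*s)) ∩ Set.Ioi 0 = Set.Ioi 0 :=
      Set.inter_eq_right.2 fun y hy => (hp y hy).ne'
    rw [this]
    simp
  · filter_upwards [ae_restrict_mem measurableSet_Ioi] with y hy
    exact (hp y hy).le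
  · exact defect_int hs hv hpos hM c

/-- the Hamiltonian-type identity -/
lemma hamiltonian {s : ℝ} (hs : s ∈ Set.Ioo (0:ℝ) 1) {v : ℝ → ℝ} (hv : ContDiff ℝ 2 v)
    (hpos : ∀ x, 0 < deriv v x) {M : ℝ} (hM : ∀ x, |v x| ≤ M) {a b : ℝ} (hab : a ≤ b) :
    ∫ x in a..b, deriv v x * fracLap s v x = fracLapCoef s * (bEn s v a - bEn s v b) := by
  have hd : Differentiable ℝ v := hv.differentiable (by norm_num)
  have hv1 : Continuous (deriv v) := hv.continuous_deriv (by norm_num)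
  have hc : Continuous v := hd.continuous
  obtain ⟨A, hA, hA1, hA2⟩ := sd_bound hv a b
  have hM0 := (abs_nonneg _).trans (hM 0)
  have hprod : Integrable (Function.uncurry fun x y : ℝ =>
      deriv v x * ((2 * v x - v (x + y) - v (x - y)) * y ^ (-1 - 2*s)))
      ((volume.restrict (Set.Ioc a b)).prod (volume.restrict (Set.Ioi 0))) := by
    have hb : Integrable (fun z : ℝ × ℝ => (A * (A + 4 * M)) *
        (min (z.2^2) 1 * z.2 ^ (-1 - 2*s)))
        ((volume.restrict (Set.Ioc a b)).prod (volume.restrict (Set.Ioi 0))) :=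
      Integrable.mul_prod (f := fun _ : ℝ => A * (A + 4 * M)) (integrable_const _) (ker_int hs)
    refine hb.mono' ?_ ?_
    · refine Measurable.aestronglyMeasurable ?_
      simp only [Function.uncurry_def]
      have m1 : Measurable fun z : ℝ × ℝ => deriv v z.1 * (2 * v z.1 - v (z.1 + z.2) - v (z.1 - z.2)) :=
        Continuous.measurable (by fun_prop)
      have m2 : Measurable fun z : ℝ × ℝ => z.2 ^ (-1 - 2*s) := by fun_prop
      simp only [← mul_assoc]
      exact m1.mul m2
    · rw [Measure.prod_restrict]
      filter_upwards [ae_restrict_mem (measurableSet_Ioc.prod measurableSet_Ioi)] with z hz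
      obtain ⟨hz1, hz2⟩ := hz
      have hz1' : z.1 ∈ Set.Icc a b := Set.Ioc_subset_Icc_self hz1
      have hS := (dom_int hs (g := fun y => 2 * v z.1 - v (z.1 + y) - v (z.1 - y))
        (Continuous.measurable (by fun_prop)) hA
        (fun y h0 h1 => (hA2 z.1 hz1' y h0 h1).2.2) (B := 4 * M) (fun y _ => by
          have a1 := abs_le.1 (hM z.1)
          have a2 := abs_le.1 (hM (z.1 + y))
          have a3 := abs_le.1 (hM (z.1 - y))
          rw [abs_le]
          constructor <;> linarith)).2 z.2 hz2
      simp only [Function.uncurry_def, norm_mul]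
      rw [mul_assoc A, ← norm_mul]
      exact mul_le_mul (hA1 _ hz1') hS (abs_nonneg _) hA
  have hswap := integral_integral_swap hprod
  have lhs : ∫ x in a..b, deriv v x * fracLap s v x = fracLapCoef s *
      ∫ x in Set.Ioc a b, ∫ y in Set.Ioi (0:ℝ),
        deriv v x * ((2 * v x - v (x + y) - v (x - y)) * y ^ (-1 - 2*s)) := by
    rw [intervalIntegral.integral_of_le hab, ← integral_const_mul]
    congr 1
    ext x
    rw [integral_const_mul, fracLap]
    ring
  rw [lhs, hswap, bEn, bEn, ← integral_sub (defect_int hs hv hpos hM a) (defect_int hs hv hpos hM b)]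
  congr 2
  ext y
  rw [← sub_mul, ← defect_diff hd hv1, intervalIntegral.integral_of_le hab, ← integral_mul_const]
  congr 1
  ext x
  ring

/-- the boundary energy vanishes along a sequence going to `-∞` -/
lemma bEn_seq {s : ℝ} (hs : s ∈ Set.Ioo (0:ℝ) 1) {v : ℝ → ℝ} (hv : ContDiff ℝ 2 v)
    (hpos : ∀ x, 0 < deriv v x) {M l : ℝ} (hM : ∀ x, |v x| ≤ M) (hl : Tendsto v atBot (nhds l))
    (hz : Tendsto (fracLap s v) atBot (nhds 0)) :
    ∃ x : ℕ → ℝ, Tendsto x atTop atBot ∧ Tendsto (fun n => bEn s v (x n)) atTop (nhds 0) := by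
  have hd : Differentiable ℝ v := hv.differentiable (by norm_num)
  have hv1 : Continuous (deriv v) := hv.continuous_deriv (by norm_num)
  have hm : StrictMono v := strictMono_of_deriv_pos hpos
  have hc : Continuous v := hd.continuous
  have hM0 := (abs_nonneg _).trans (hM 0)
  obtain ⟨C, hC, x, c, hx, hcb, ht⟩ := touch hc hM
  obtain ⟨hi, hlim⟩ := neg_part hs hc hM hl hx ht
  refine ⟨x, hx, ?_⟩
  have pm : ∀ n, Measurable fun y : ℝ => (v (x n + y) - v (x n))^2 :=
    fun n => Continuous.measurable (by fun_prop)
  have p0 : ∀ n, ∀ y : ℝ, 0 < y → 0 ≤ v (x n + y) - v (x n) := fun n y hy =>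
    sub_nonneg.2 (hm.monotone (by linarith))
  have p2 : ∀ n, ∀ y : ℝ, v (x n + y) - v (x n) ≤ 2 * M := fun n y => by
    have a1 := abs_le.1 (hM (x n))
    have a2 := abs_le.1 (hM (x n + y))
    linarith
  have h1 : ∀ n, ∀ y : ℝ, 0 < y → y ≤ 1 → |(v (x n + y) - v (x n))^2| ≤ (C + 1)^2 * y^2 := by
    intro n y hy hy1
    rw [abs_of_nonneg (sq_nonneg _), ← mul_pow]
    refine pow_le_pow_left₀ (p0 n y hy) ((ht n y).trans ?_) 2
    nlinarith [mul_le_mul_of_nonneg_right ((le_abs_self _).trans (hcb n)) hy.le]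
  have h2 : ∀ n, ∀ y : ℝ, 0 < y → |(v (x n + y) - v (x n))^2| ≤ (2 * M)^2 := by
    intro n y hy
    rw [abs_of_nonneg (sq_nonneg _)]
    exact pow_le_pow_left₀ (p0 n y hy) (p2 n y) 2
  have pi := fun n => (dom_int hs (pm n) (sq_nonneg _) (h1 n) (h2 n)).1
  have plim := dom_conv hs pm (sq_nonneg _) h1 h2 (by
    intro y _
    have b1 := hl.comp hx
    have b2 := hl.comp (tendsto_atBot_add_const_right _ y hx)
    simpa using (b2.sub b1).pow 2)
  have si : ∀ n, IntegrableOn (fun y : ℝ =>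
      (2 * v (x n) - v (x n + y) - v (x n - y)) * y ^ (-1 - 2*s)) (Set.Ioi 0) := by
    intro n
    obtain ⟨A, hA, -, hA2⟩ := sd_bound hv (x n) (x n)
    refine (dom_int hs (g := fun y => 2 * v (x n) - v (x n + y) - v (x n - y))
        (Continuous.measurable (by fun_prop)) hA
        (fun y h0 h1 => (hA2 (x n) ⟨le_refl _, le_refl _⟩ y h0 h1).2.2) (B := 4 * M) (fun y _ => ?_)).1
    have a1 := abs_le.1 (hM (x n))
    have a2 := abs_le.1 (hM (x n + y))
    have a3 := abs_le.1 (hM (x n - y))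
    rw [abs_le]
    constructor <;> linarith
  have slim : Tendsto (fun n => ∫ y in Set.Ioi (0:ℝ),
      (2 * v (x n) - v (x n + y) - v (x n - y)) * y ^ (-1 - 2*s)) atTop (nhds 0) := by
    have := (hz.comp hx).const_mul (fracLapCoef s)⁻¹
    rw [mul_zero] at this
    refine this.congr fun n => ?_
    simp only [Function.comp, fracLap]
    rw [inv_mul_cancel_left₀ (coef_pos hs).ne']
  have hsum := plim.add ((slim.add hlim).const_mul (2 * M))
  simp only [add_zero, mul_zero] at hsum
  refine squeeze_zero (fun n => (bEn_pos hs hv hpos hM (x n)).le) (fun n => ?_) hsum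
  have hj : IntegrableOn (fun y : ℝ => 2 * M * ((2 * v (x n) - v (x n + y) - v (x n - y)) *
      y ^ (-1 - 2*s) + max (-(2 * v (x n) - v (x n + y) - v (x n - y))) 0 * y ^ (-1 - 2*s)))
      (Set.Ioi 0) := ((si n).add (hi n)).const_mul _
  rw [← integral_add (si n) (hi n), ← integral_const_mul, ← integral_add (pi n) hj, bEn]
  refine setIntegral_mono_on (defect_int hs hv hpos hM (x n))
    ((pi n).add hj) measurableSet_Ioi fun y hy => ?_
  have hk : 0 ≤ y ^ (-1 - 2*s) := rpow_nonneg (le_of_lt hy) _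
  rw [← add_mul, ← mul_assoc, ← add_mul]
  refine mul_le_mul_of_nonneg_right ?_ hk
  refine (defect_bounds hd hv1 hpos (x n) y hy).2.trans ?_
  set p := v (x n + y) - v (x n) with hp
  set S := 2 * v (x n) - v (x n + y) - v (x n - y) with hS
  have hq : v (x n) - v (x n - y) = p + S := by rw [hp, hS]; ring
  rw [hq]
  have q0 : 0 ≤ p := p0 n y hy
  have q2 : p ≤ 2 * M := p2 n y
  have r1 : 0 ≤ S + max (-S) 0 := by linarith [le_max_left (-S) 0]
  have r2 : 0 ≤ max (-S) 0 := le_max_right _ _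
  nlinarith [mul_nonneg (sub_nonneg.2 q2) r1, mul_nonneg q0 r2]

lemma core {s : ℝ} (hs : s ∈ Set.Ioo (0:ℝ) 1) {f : ℝ → ℝ} (hf : Continuous f) {v : ℝ → ℝ}
    (hv : IsLayerSolution s f v) :
    f (-1) = 0 ∧ (∀ b, ∫ u in (0:ℝ)..(v b), f u < ∫ u in (0:ℝ)..(-1), f u) ∧
      ∫ u in (0:ℝ)..1, f u ≤ ∫ u in (0:ℝ)..(-1), f u := by
  obtain ⟨⟨M, hM⟩, hsm, heq, hpos, hneg, hp⟩ := hv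
  have hd : Differentiable ℝ v := hsm.differentiable (by norm_num)
  have hv1 : Continuous (deriv v) := hsm.continuous_deriv (by norm_num)
  have hc : Continuous v := hd.continuous
  have hL : fracLap s v = fun x => f (v x) := funext heq
  have hLlim : Tendsto (fracLap s v) atBot (nhds (f (-1))) := by
    rw [hL]
    exact (hf.tendsto _).comp hneg
  have f0 : f (-1) = 0 := by
    refine le_antisymm ?_ (lap_nonneg hs hc hM hneg hLlim)
    have := lap_nonneg hs (w := fun t => - v t) (m := - f (-1)) hc.neg
      (fun x => by rw [abs_neg]; exact hM x) hneg.neg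
      (by
        have : fracLap s (fun t => - v t) = fun x => - fracLap s v x := funext (fracLap_neg s v)
        rw [this]
        exact hLlim.neg)
    linarith
  rw [f0] at hLlim
  obtain ⟨x, hx, hE⟩ := bEn_seq hs hsm hpos hM hneg hLlim
  set F : ℝ → ℝ := fun r => ∫ u in (0:ℝ)..r, f u with hF
  have hFd : ∀ r, HasDerivAt F (f r) r := fun r => (hf.integral_hasStrictDerivAt 0 r).hasDerivAt
  have hFc : Continuous F := continuous_iff_continuousAt.2 fun r => (hFd r).continuousAt
  have hid : ∀ a b, a ≤ b →
      F (v b) - F (v a) = fracLapCoef s * (bEn s v a - bEn s v b) := by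
    intro a b hab
    rw [← hamiltonian hs hsm hpos hM hab, hL]
    rw [intervalIntegral.integral_eq_sub_of_hasDerivAt (f := fun x => F (v x))
      (f' := fun x => deriv v x * f (v x))]
    · intro z _
      rw [mul_comm]
      exact (hFd (v z)).comp z (hd z).hasDerivAt
    · exact Continuous.intervalIntegrable (by fun_prop) _ _
  have hlt : ∀ b, F (v b) < F (-1) := by
    intro b
    have l1 : Tendsto (fun n => F (v b) - F (v (x n))) atTop (nhds (F (v b) - F (-1))) :=
      tendsto_const_nhds.sub ((hFc.tendsto _).comp (hneg.comp hx))
    have l2 : Tendsto (fun n => fracLapCoef s * (bEn s v (x n) - bEn s v b)) atTop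
        (nhds (fracLapCoef s * (0 - bEn s v b))) := (hE.sub_const _).const_mul _
    have l3 := tendsto_nhds_unique (l1.congr' (by
      filter_upwards [hx.eventually_le_atBot b] with n hn
      exact hid (x n) b hn)) l2
    have := mul_pos (coef_pos hs) (bEn_pos hs hsm hpos hM b)
    linarith
  refine ⟨f0, hlt, ?_⟩
  exact le_of_tendsto' ((hFc.tendsto _).comp hp) fun b => (hlt b).le

lemma layer_refl {s : ℝ} {f : ℝ → ℝ} {v : ℝ → ℝ} (hv : IsLayerSolution s f v) :
    IsLayerSolution s (fun u => - f (-u)) (fun x => - v (-x)) := by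
  obtain ⟨⟨M, hM⟩, hsm, heq, hpos, hneg, hp⟩ := hv
  refine ⟨⟨M, fun x => by rw [abs_neg]; exact hM _⟩, ?_, ?_, ?_, ?_, ?_⟩
  · exact (hsm.comp contDiff_neg).neg
  · intro x
    rw [fracLap_neg s (fun t => v (-t)), fracLap_refl, heq, neg_neg]
  · intro x
    rw [deriv.fun_neg, deriv_comp_neg, neg_neg]
    exact hpos _
  · exact (hp.comp tendsto_neg_atBot_atTop).neg
  · simpa using (hneg.comp tendsto_neg_atTop_atBot).neg

/-- Necessary conditions on `G` for the existence of a layer solution in `ℝ`. -/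
theorem statement0 (s γ : ℝ) (hs : s ∈ Set.Ioo (0:ℝ) 1)
    (hγ : max 0 (1 - 2*s) < γ)
    (f : ℝ → ℝ) (hf : IsC1Holder γ f)
    (v : ℝ → ℝ) (hv : IsLayerSolution s f v) :
    f (-1) = 0 ∧ f 1 = 0 ∧ potG f (-1) = potG f 1 ∧
      ∀ r ∈ Set.Ioo (-1:ℝ) 1, potG f (-1) < potG f r := by
  have hfc : Continuous f := hf.1.continuous
  obtain ⟨h1, h2, h3⟩ := core hs hfc hv
  obtain ⟨g1, -, g3⟩ := core hs (f := fun u => - f (-u)) (by fun_prop) (layer_refl hv)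
  have hF : ∀ r : ℝ, ∫ u in (0:ℝ)..r, - f (-u) = ∫ u in (0:ℝ)..(-r), f u := by
    intro r
    rw [intervalIntegral.integral_neg, intervalIntegral.integral_comp_neg,
      intervalIntegral.integral_symm]
    simp
  rw [hF, hF, neg_neg] at g3
  refine ⟨h1, by simpa using g1, ?_, ?_⟩
  · unfold potG
    rw [le_antisymm h3 g3]
  · intro r hr
    obtain ⟨b, rfl⟩ : ∃ b, v b = r := mem_range_of_exists_le_of_exists_ge hv.smooth.continuous
      ((hv.limNeg.eventually (gt_mem_nhds hr.1)).exists.imp fun _ h => h.le)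
      ((hv.limPos.eventually (lt_mem_nhds hr.2)).exists.imp fun _ h => h.le)
    unfold potG
    linarith [h2 b]
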